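/- Let g be an isometry of finite order of the lattice 𝐋 = 3U ⊕ 2E8 ⊕ A2 such that the coinvariant sublattice 𝐋_g is negative definite and 𝐋_g contains no element of 𝒲_{OG10}. Then g is the identity. -/

import Mathlib

open Matrix

/-- Gram matrix of the lattice `𝐋 = 3U ⊕ 2E8 ⊕ A2` (with `E8` negative definite):
three hyperbolic blocks, two copies of the negative definite `E8` Gram matrix,
and the `A2` block `!![-2,1;1,-2]`. -/
def LGram : Matrix (Fin 24) (Fin 24) ℤ :=
  !![0, 1, 0, 0, 0, 0, 0, 0, 0, 0, 0, 0, 0, 0, 0, 0, 0, 0, 0, 0, 0, 0, 0, 0;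
    1, 0, 0, 0, 0, 0, 0, 0, 0, 0, 0, 0, 0, 0, 0, 0, 0, 0, 0, 0, 0, 0, 0, 0;
    0, 0, 0, 1, 0, 0, 0, 0, 0, 0, 0, 0, 0, 0, 0, 0, 0, 0, 0, 0, 0, 0, 0, 0;
    0, 0, 1, 0, 0, 0, 0, 0, 0, 0, 0, 0, 0, 0, 0, 0, 0, 0, 0, 0, 0, 0, 0, 0;
    0, 0, 0, 0, 0, 1, 0, 0, 0, 0, 0, 0, 0, 0, 0, 0, 0, 0, 0, 0, 0, 0, 0, 0;
    0, 0, 0, 0, 1, 0, 0, 0, 0, 0, 0, 0, 0, 0, 0, 0, 0, 0, 0, 0, 0, 0, 0, 0;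
    0, 0, 0, 0, 0, 0, -2, 0, 1, 0, 0, 0, 0, 0, 0, 0, 0, 0, 0, 0, 0, 0, 0, 0;
    0, 0, 0, 0, 0, 0, 0, -2, 0, 1, 0, 0, 0, 0, 0, 0, 0, 0, 0, 0, 0, 0, 0, 0;
    0, 0, 0, 0, 0, 0, 1, 0, -2, 1, 0, 0, 0, 0, 0, 0, 0, 0, 0, 0, 0, 0, 0, 0;
    0, 0, 0, 0, 0, 0, 0, 1, 1, -2, 1, 0, 0, 0, 0, 0, 0, 0, 0, 0, 0, 0, 0, 0;
    0, 0, 0, 0, 0, 0, 0, 0, 0, 1, -2, 1, 0, 0, 0, 0, 0, 0, 0, 0, 0, 0, 0, 0;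
    0, 0, 0, 0, 0, 0, 0, 0, 0, 0, 1, -2, 1, 0, 0, 0, 0, 0, 0, 0, 0, 0, 0, 0;
    0, 0, 0, 0, 0, 0, 0, 0, 0, 0, 0, 1, -2, 1, 0, 0, 0, 0, 0, 0, 0, 0, 0, 0;
    0, 0, 0, 0, 0, 0, 0, 0, 0, 0, 0, 0, 1, -2, 0, 0, 0, 0, 0, 0, 0, 0, 0, 0;
    0, 0, 0, 0, 0, 0, 0, 0, 0, 0, 0, 0, 0, 0, -2, 0, 1, 0, 0, 0, 0, 0, 0, 0;
    0, 0, 0, 0, 0, 0, 0, 0, 0, 0, 0, 0, 0, 0, 0, -2, 0, 1, 0, 0, 0, 0, 0, 0;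
    0, 0, 0, 0, 0, 0, 0, 0, 0, 0, 0, 0, 0, 0, 1, 0, -2, 1, 0, 0, 0, 0, 0, 0;
    0, 0, 0, 0, 0, 0, 0, 0, 0, 0, 0, 0, 0, 0, 0, 1, 1, -2, 1, 0, 0, 0, 0, 0;
    0, 0, 0, 0, 0, 0, 0, 0, 0, 0, 0, 0, 0, 0, 0, 0, 0, 1, -2, 1, 0, 0, 0, 0;
    0, 0, 0, 0, 0, 0, 0, 0, 0, 0, 0, 0, 0, 0, 0, 0, 0, 0, 1, -2, 1, 0, 0, 0;
    0, 0, 0, 0, 0, 0, 0, 0, 0, 0, 0, 0, 0, 0, 0, 0, 0, 0, 0, 1, -2, 1, 0, 0;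
    0, 0, 0, 0, 0, 0, 0, 0, 0, 0, 0, 0, 0, 0, 0, 0, 0, 0, 0, 0, 1, -2, 0, 0;
    0, 0, 0, 0, 0, 0, 0, 0, 0, 0, 0, 0, 0, 0, 0, 0, 0, 0, 0, 0, 0, 0, -2, 1;
    0, 0, 0, 0, 0, 0, 0, 0, 0, 0, 0, 0, 0, 0, 0, 0, 0, 0, 0, 0, 0, 0, 1, -2]

/-- The bilinear form of the lattice `𝐋`. -/
def Bf (v w : Fin 24 → ℤ) : ℤ := v ⬝ᵥ (LGram *ᵥ w)

/-- An isometry of `𝐋` is a `ℤ`-linear automorphism preserving the bilinear form. -/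
def IsIsometry (g : (Fin 24 → ℤ) ≃ₗ[ℤ] (Fin 24 → ℤ)) : Prop :=
  ∀ v w, Bf (g v) (g w) = Bf v w

/-- The invariant sublattice `𝐋^g = {v ∈ 𝐋 : g v = v}`. -/
def invL (g : (Fin 24 → ℤ) ≃ₗ[ℤ] (Fin 24 → ℤ)) : Submodule ℤ (Fin 24 → ℤ) where
  carrier := {v | g v = v}
  add_mem' := by intro a b ha hb; simp only [Set.mem_setOf_eq, map_add] at *; rw [ha, hb]
  zero_mem' := by simp
  smul_mem' := by intro c a ha; simp only [Set.mem_setOf_eq, _root_.map_smul] at *; rw [ha]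

/-- The coinvariant sublattice `𝐋_g = {v ∈ 𝐋 : v·w = 0 for all w ∈ 𝐋^g}`. -/
def coinvL (g : (Fin 24 → ℤ) ≃ₗ[ℤ] (Fin 24 → ℤ)) : Submodule ℤ (Fin 24 → ℤ) where
  carrier := {v | ∀ w ∈ invL g, Bf v w = 0}
  add_mem' := by
    intro a b ha hb w hw
    simp only [Bf, add_dotProduct] at *
    rw [ha w hw, hb w hw, add_zero]
  zero_mem' := by intro w hw; simp [Bf]
  smul_mem' := by
    intro c a ha w hw
    simp only [Bf, smul_dotProduct] at *
    rw [ha w hw, smul_zero]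

/-- The divisibility of `v` in `𝐋` is `d`, i.e. `gcd {v·w : w ∈ 𝐋} = d`. -/
def HasDivisibility (v : Fin 24 → ℤ) (d : ℤ) : Prop :=
  (∀ w, d ∣ Bf v w) ∧ ∀ e : ℤ, (∀ w, e ∣ Bf v w) → e ∣ d

/-- Membership in the wall set `𝒲_{OG10}`. -/
def InW (v : Fin 24 → ℤ) : Prop :=
  Bf v v = -2 ∨ Bf v v = -4 ∨ (Bf v v = -6 ∧ HasDivisibility v 3) ∨
    (Bf v v = -24 ∧ HasDivisibility v 3)


/-- pairwise distances versus distances from the origin -/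
lemma sum_sq_dist_le {E : Type*} [NormedAddCommGroup E] [InnerProductSpace ℝ E]
    {ι : Type*} (F : Finset ι) (x : ι → E) :
    ∑ i ∈ F, ∑ j ∈ F, ‖x i - x j‖ ^ 2 ≤ 2 * F.card * ∑ i ∈ F, ‖x i‖ ^ 2 := by
  have h : ∀ i j, ‖x i - x j‖ ^ 2 = ‖x i‖ ^ 2 + ‖x j‖ ^ 2 - 2 * inner ℝ (x i) (x j) := by
    intro i j; rw [norm_sub_sq_real]; ring
  simp_rw [h, Finset.sum_sub_distrib, Finset.sum_add_distrib, ← Finset.mul_sum, ← inner_sum,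
    ← sum_inner, Finset.sum_const, nsmul_eq_mul, ← Finset.mul_sum]
  have := real_inner_self_nonneg (x := ∑ i ∈ F, x i)
  linarith

lemma blich_point {E : Type*} [NormedAddCommGroup E] [InnerProductSpace ℝ E]
    (Λ : Submodule ℤ E) (h : ∀ x ∈ Λ, x ≠ 0 → 6 ≤ ‖x‖ ^ 2) (y : E) (F : Finset Λ) :
    ∑ v ∈ F, max 0 (1 - ‖(v : E) + y‖ ^ 2 / 3) ≤ 1 := by
  classical
  set F' : Finset Λ := F.filter (fun v : Λ => 0 ≤ 1 - ‖(v : E) + y‖ ^ 2 / 3) with hF'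
  have h1 : ∑ v ∈ F, max 0 (1 - ‖(v : E) + y‖ ^ 2 / 3)
      = ∑ v ∈ F', (1 - ‖(v : E) + y‖ ^ 2 / 3) := by
    rw [hF', Finset.sum_filter]
    refine Finset.sum_congr rfl fun v _ => ?_
    split_ifs with hv
    · exact max_eq_right hv
    · exact max_eq_left (le_of_not_ge hv)
  rw [h1]
  rcases Finset.eq_empty_or_nonempty F' with he | hne
  · simp [he]
  have h2 := sum_sq_dist_le F' (fun v : Λ => (v : E) + y)
  have h3 : ∑ i ∈ F', ∑ j ∈ F', (if i = j then (0:ℝ) else 6) ≤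
      ∑ i ∈ F', ∑ j ∈ F', ‖((i : E) + y) - ((j : E) + y)‖ ^ 2 := by
    refine Finset.sum_le_sum fun i _ => Finset.sum_le_sum fun j _ => ?_
    split_ifs with hij
    · positivity
    · rw [add_sub_add_right_eq_sub]
      exact h _ (Λ.sub_mem i.2 j.2) (fun h0 => hij (Subtype.ext (sub_eq_zero.mp h0)))
  have h4 : ∑ i ∈ F', ∑ j ∈ F', (if i = j then (0:ℝ) else 6) =
      F'.card * (6 * (F'.card - 1)) := by
    have : ∀ i ∈ F', ∑ j ∈ F', (if i = j then (0:ℝ) else 6) = 6 * (F'.card - 1) := by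
      intro i hi
      have : ∀ j ∈ F', (if i = j then (0:ℝ) else 6) = 6 - (if i = j then 6 else 0) := by
        intro j _; split_ifs <;> simp
      rw [Finset.sum_congr rfl this, Finset.sum_sub_distrib, Finset.sum_ite_eq, if_pos hi]
      simp; ring
    rw [Finset.sum_congr rfl this]; simp
  have hk : (0:ℝ) < F'.card := by exact_mod_cast hne.card_pos
  have h5 : (F'.card : ℝ) * (6 * (F'.card - 1)) ≤
      F'.card * (2 * ∑ v ∈ F', ‖(v : E) + y‖ ^ 2) := by
    rw [← h4]; refine (h3.trans h2).trans (le_of_eq ?_); ring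
  have h6 := le_of_mul_le_mul_left h5 hk
  rw [Finset.sum_sub_distrib, ← Finset.sum_div]
  simp only [Finset.sum_const, nsmul_eq_mul, mul_one]
  linarith

open MeasureTheory ENNReal in
lemma blich_lintegral {r : ℕ} (B : Module.Basis (Fin r) ℝ (EuclideanSpace ℝ (Fin r)))
    (h : ∀ x ∈ Submodule.span ℤ (Set.range B), x ≠ 0 → 6 ≤ ‖x‖ ^ 2) :
    ∫⁻ x : EuclideanSpace ℝ (Fin r), ENNReal.ofReal (max 0 (1 - ‖x‖ ^ 2 / 3)) ≤
      volume (ZSpan.fundamentalDomain B) := by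
  have hf := ZSpan.isAddFundamentalDomain' B volume
  have : Countable (Submodule.span ℤ (Set.range B)).toAddSubgroup :=
    inferInstanceAs (Countable (Submodule.span ℤ (Set.range B)))
  rw [hf.lintegral_eq_tsum'', ← lintegral_tsum]
  · calc _ ≤ ∫⁻ x in ZSpan.fundamentalDomain B, 1 := by
          refine lintegral_mono fun y => ?_
          rw [ENNReal.tsum_eq_iSup_sum]
          refine iSup_le fun F => ?_
          rw [← ENNReal.ofReal_sum_of_nonneg (fun _ _ => le_max_left _ _), ← ENNReal.ofReal_one]
          exact ENNReal.ofReal_le_ofReal (blich_point _ h y F)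
      _ = _ := by simp
  · intro i
    refine Measurable.aemeasurable ?_
    have : Continuous fun x : EuclideanSpace ℝ (Fin r) => 
      ENNReal.ofReal (max 0 (1 - ‖i +ᵥ x‖ ^ 2 / 3)) := by
      refine ENNReal.continuous_ofReal.comp ?_
      have : Continuous fun x : EuclideanSpace ℝ (Fin r) => i +ᵥ x := by
        change Continuous fun x : EuclideanSpace ℝ (Fin r) => (i : EuclideanSpace ℝ (Fin r)) + x
        fun_prop
      fun_prop
    exact this.measurable

lemma radial_integral (r : ℕ) (hr : 0 < r) :
    ∫ y in Set.Ioi (0 : ℝ), y ^ (r - 1) • max 0 (1 - y ^ 2 / 3) = (√3) ^ r * (2 / (r * (r + 2))) := by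
  have h0 : (0:ℝ) ≤ √3 := Real.sqrt_nonneg 3
  have hs : (√3 : ℝ) ^ 2 = 3 := Real.sq_sqrt (by norm_num)
  have h1 : ∫ y in Set.Ioi (0 : ℝ), y ^ (r - 1) • max 0 (1 - y ^ 2 / 3) =
      ∫ y in Set.Ioc (0 : ℝ) (√3), y ^ (r - 1) * (1 - y ^ 2 / 3) := by
    rw [MeasureTheory.setIntegral_eq_of_subset_of_forall_sdiff_eq_zero (s := Set.Ioc (0:ℝ) (√3))
      (t := Set.Ioi 0) measurableSet_Ioi Set.Ioc_subset_Ioi_self]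
    · refine MeasureTheory.setIntegral_congr_fun measurableSet_Ioc fun y hy => ?_
      have : y ^ 2 ≤ 3 := by rw [← hs]; exact pow_le_pow_left₀ hy.1.le hy.2 2
      simp only [smul_eq_mul]
      rw [max_eq_right (by linarith)]
    · intro y hy
      have hy1 : √3 < y := by
        by_contra hc
        exact hy.2 ⟨hy.1, not_lt.mp hc⟩
      have : 3 ≤ y ^ 2 := by rw [← hs]; exact pow_le_pow_left₀ h0 hy1.le 2
      rw [max_eq_left (by linarith)]; simp
  rw [h1, ← intervalIntegral.integral_of_le h0]
  obtain ⟨k, rfl⟩ : ∃ k, r = k + 1 := ⟨r - 1, by omega⟩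
  have h2 : ∀ y : ℝ, y ^ (k + 1 - 1) * (1 - y ^ 2 / 3) = y ^ k - y ^ (k + 2) / 3 := by
    intro y; simp only [Nat.add_sub_cancel]; ring
  simp_rw [h2]
  rw [intervalIntegral.integral_sub (by simp) (by simp), intervalIntegral.integral_div,
    integral_pow, integral_pow]
  have : (√3 : ℝ) ^ (k + 2 + 1) = (√3) ^ (k+1) * 3 := by
    rw [show k + 2 + 1 = k + 1 + 2 by ring, pow_add, hs]
  rw [this]
  push_cast
  have hk : (k:ℝ) + 1 ≠ 0 := by positivity
  have hk : (k:ℝ) + 3 ≠ 0 := by positivity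
  simp only [ne_eq, Nat.add_eq_zero_iff, one_ne_zero, and_false, not_false_eq_true, zero_pow, sub_zero, OfNat.ofNat_ne_zero]
  field_simp
  ring

open MeasureTheory ENNReal in
lemma blich_vol {r : ℕ} (hr : 0 < r) (B : Module.Basis (Fin r) ℝ (EuclideanSpace ℝ (Fin r)))
    (h : ∀ x ∈ Submodule.span ℤ (Set.range B), x ≠ 0 → 6 ≤ ‖x‖ ^ 2) :
    √3 ^ r * (√Real.pi ^ r / Real.Gamma (r / 2 + 1)) * (2 / (r + 2)) ≤
      |(EuclideanSpace.basisFun (Fin r) ℝ).toBasis.det B| := by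
  have : Nonempty (Fin r) := ⟨⟨0, hr⟩⟩
  have h1 := blich_lintegral B h
  rw [ZSpan.measure_fundamentalDomain B volume (EuclideanSpace.basisFun (Fin r) ℝ).toBasis,
    measure_congr (ZSpan.fundamentalDomain_ae_parallelepiped _ volume)] at h1
  have hp := (EuclideanSpace.basisFun (Fin r) ℝ).volume_parallelepiped
  rw [OrthonormalBasis.coe_toBasis, hp, mul_one] at h1
  have h2 := ENNReal.toReal_mono ENNReal.ofReal_ne_top h1
  rw [ENNReal.toReal_ofReal (abs_nonneg _)] at h2
  rw [← integral_eq_lintegral_of_nonneg_ae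
    (f := fun x : EuclideanSpace ℝ (Fin r) => max 0 (1 - ‖x‖ ^ 2 / 3)) (Filter.Eventually.of_forall fun _ => le_max_left _ _)
    (by apply Continuous.aestronglyMeasurable; fun_prop)] at h2
  refine le_trans (le_of_eq ?_) h2
  have : Nontrivial (EuclideanSpace ℝ (Fin r)) := by infer_instance
  rw [integral_fun_norm_addHaar volume (fun t => max 0 (1 - t ^ 2 / 3))]
  rw [finrank_euclideanSpace_fin, radial_integral r hr, measureReal_def, EuclideanSpace.volume_ball]
  have hg : 0 < Real.Gamma (r / 2 + 1) := Real.Gamma_pos_of_pos (by positivity)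
  simp only [ENNReal.ofReal_one, one_pow, one_mul, Fintype.card_fin]
  rw [ENNReal.toReal_ofReal (by positivity)]
  simp only [nsmul_eq_mul, smul_eq_mul]
  have : (r:ℝ) ≠ 0 := by positivity
  field_simp

lemma psd_of_int {r : ℕ} (G : Matrix (Fin r) (Fin r) ℤ)
    (hpos : ∀ x : Fin r → ℤ, x ≠ 0 → 6 ≤ x ⬝ᵥ (G *ᵥ x)) (x : Fin r → ℝ) :
    0 ≤ x ⬝ᵥ ((G.map (Int.cast : ℤ → ℝ)) *ᵥ x) := by
  have hd : DenseRange (fun (q : Fin r → ℚ) (i : Fin r) => ((q i : ℚ) : ℝ)) :=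
    DenseRange.piMap (fun _ => Rat.denseRange_cast)
  have hc : IsClosed {x : Fin r → ℝ | 0 ≤ x ⬝ᵥ ((G.map (Int.cast : ℤ → ℝ)) *ᵥ x)} := by
    refine isClosed_le continuous_const ?_
    simp only [dotProduct, mulVec]
    fun_prop
  refine hd.induction_on (p := fun x => 0 ≤ x ⬝ᵥ ((G.map (Int.cast : ℤ → ℝ)) *ᵥ x)) x hc ?_
  intro q
  obtain ⟨N, hN, z, hz⟩ : ∃ N : ℝ, 0 < N ∧ ∃ z : Fin r → ℤ, ∀ i, ((z i : ℤ) : ℝ) = N * (q i : ℝ) := by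
    refine ⟨((∏ i, (q i).den : ℕ) : ℝ), by
      exact_mod_cast Finset.prod_pos fun i _ => (q i).den_pos, ?_⟩
    have : ∀ i, ∃ z : ℤ, (z : ℝ) = ((∏ i, (q i).den : ℕ) : ℝ) * (q i : ℝ) := by
      intro i
      refine ⟨(∏ j ∈ Finset.univ.erase i, ((q j).den : ℤ)) * (q i).num, ?_⟩
      rw [← Finset.mul_prod_erase Finset.univ (fun i => (q i).den) (Finset.mem_univ i)]
      have h1 : ((q i).den : ℝ) * (q i : ℝ) = (q i).num := by
        exact_mod_cast Rat.den_mul_eq_num (q i)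
      push_cast
      rw [← h1]; ring
    choose z hz using this
    exact ⟨z, hz⟩
  have h0 : (0 : ℝ) ≤ (((z ⬝ᵥ (G *ᵥ z) : ℤ)) : ℝ) := by
    by_cases h : z = 0
    · simp [h]
    · exact_mod_cast le_trans (by norm_num) (hpos z h)
  have h1 : (((z ⬝ᵥ (G *ᵥ z) : ℤ)) : ℝ) = N ^ 2 *
      ((fun i => (q i : ℝ)) ⬝ᵥ ((G.map (Int.cast : ℤ → ℝ)) *ᵥ (fun i => (q i : ℝ)))) := by
    simp only [dotProduct, mulVec, Matrix.map_apply]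
    push_cast
    rw [Finset.mul_sum]
    refine Finset.sum_congr rfl fun i _ => ?_
    rw [Finset.mul_sum, Finset.mul_sum, Finset.mul_sum]
    refine Finset.sum_congr rfl fun j _ => ?_
    rw [hz, hz]; ring
  rw [h1] at h0
  exact nonneg_of_mul_nonneg_right h0 (by positivity)

theorem blich_matrix {r : ℕ} (hr : 0 < r) (G : Matrix (Fin r) (Fin r) ℤ) (hsym : Gᵀ = G)
    (hpos : ∀ x : Fin r → ℤ, x ≠ 0 → 6 ≤ x ⬝ᵥ (G *ᵥ x)) :
    0 < G.det ∧ 4 * (3 * Real.pi) ^ r ≤ G.det * ((r + 2) * Real.Gamma (r / 2 + 1)) ^ 2 := by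
  set GR : Matrix (Fin r) (Fin r) ℝ := G.map (Int.cast : ℤ → ℝ) with hGR
  have hdetR : GR.det = (G.det : ℝ) := by
    rw [hGR]; exact (Int.cast_det G).symm
  have hdet : G.det ≠ 0 := by
    intro h0
    obtain ⟨v, hv, hv0⟩ := Matrix.exists_mulVec_eq_zero_iff.mpr h0
    have := hpos v hv
    rw [hv0, dotProduct_zero] at this
    omega
  have hpsd : GR.PosSemidef := by
    refine Matrix.PosSemidef.of_dotProduct_mulVec_nonneg ?_ ?_
    · rw [Matrix.IsHermitian, Matrix.conjTranspose_eq_transpose_of_trivial, hGR,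
        ← Matrix.transpose_map, hsym]
    · intro x; simpa using psd_of_int G hpos x
  obtain ⟨A, hA⟩ : ∃ A : Matrix (Fin r) (Fin r) ℝ, GR = Aᵀ * A := by
    open scoped MatrixOrder in
    obtain ⟨A, hA⟩ := CStarAlgebra.nonneg_iff_eq_star_mul_self.mp hpsd.nonneg
    exact ⟨A, by rw [hA, Matrix.star_eq_conjTranspose,
      Matrix.conjTranspose_eq_transpose_of_trivial]⟩
  have hdA : A.det ^ 2 = (G.det : ℝ) := by
    rw [← hdetR, hA, det_mul, det_transpose, sq]
  have hA0 : A.det ≠ 0 := by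
    intro h; rw [h] at hdA; apply hdet; exact_mod_cast (by simpa using hdA.symm : (G.det : ℝ) = 0)
  have hGpos : 0 < G.det := by
    have : (0:ℝ) < (G.det : ℝ) := by rw [← hdA]; positivity
    exact_mod_cast this
  refine ⟨hGpos, ?_⟩
  let b₀ := (EuclideanSpace.basisFun (Fin r) ℝ).toBasis
  let e : EuclideanSpace ℝ (Fin r) ≃ₗ[ℝ] EuclideanSpace ℝ (Fin r) :=
    Matrix.toLinearEquiv b₀ A (isUnit_iff_ne_zero.mpr hA0)
  let B := b₀.map e
  have hBdet : b₀.det B = A.det := by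
    rw [Module.Basis.det_apply]
    congr 1
    ext i j
    rw [Module.Basis.toMatrix_apply]
    change b₀.repr (e (b₀ j)) i = A i j
    change b₀.repr (Matrix.toLin b₀ b₀ A (b₀ j)) i = A i j
    rw [Matrix.toLin_self]
    simp [b₀.repr_self, Finsupp.single_apply]
  have hn : ∀ z : Fin r → ℤ, ‖∑ i, z i • B i‖ ^ 2 = ((z ⬝ᵥ (G *ᵥ z) : ℤ) : ℝ) := by
    intro z
    have h1 : ∀ k, (∑ i, z i • B i) k = ∑ i, A k i * z i := by
      intro k
      have : ∀ i, (B i) k = A k i := by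
        intro i
        change (e (b₀ i)) k = A k i
        change (Matrix.toLin b₀ b₀ A (b₀ i)) k = A k i
        rw [Matrix.toLin_self]
        simp [b₀, Pi.single_apply]
      simp [this, mul_comm]
    rw [EuclideanSpace.norm_sq_eq]
    simp_rw [h1]
    have h2 : ((z ⬝ᵥ (G *ᵥ z) : ℤ) : ℝ) = (fun i => (z i : ℝ)) ⬝ᵥ (GR *ᵥ (fun i => (z i : ℝ))) := by
      simp [dotProduct, mulVec, hGR]
    rw [h2, hA, ← Matrix.mulVec_mulVec, Matrix.dotProduct_mulVec, Matrix.vecMul_transpose]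
    simp [dotProduct, mulVec, sq]
  have key := blich_vol hr B (by
    intro x hx hx0
    rw [Submodule.mem_span_range_iff_exists_fun] at hx
    obtain ⟨z, rfl⟩ := hx
    rw [hn]
    have : z ≠ 0 := by rintro rfl; simp at hx0
    exact_mod_cast hpos z this)
  rw [hBdet] at key
  have hg : 0 < Real.Gamma (r / 2 + 1) := Real.Gamma_pos_of_pos (by positivity)
  have k2 := pow_le_pow_left₀ (by positivity) key 2
  rw [sq_abs, hdA] at k2
  have h3 : (√3 ^ r * (√Real.pi ^ r / Real.Gamma (r / 2 + 1)) * (2 / (r + 2))) ^ 2 =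
      4 * (3 * Real.pi) ^ r / ((r + 2) * Real.Gamma (r / 2 + 1)) ^ 2 := by
    have s1 : (√3 ^ r) ^ 2 = (3:ℝ) ^ r := by
      rw [← pow_mul, mul_comm, pow_mul, Real.sq_sqrt (by norm_num)]
    have s2 : (√Real.pi ^ r) ^ 2 = Real.pi ^ r := by
      rw [← pow_mul, mul_comm, pow_mul, Real.sq_sqrt Real.pi_pos.le]
    rw [mul_pow, mul_pow, div_pow, div_pow, s1, s2, mul_pow, mul_pow]
    field_simp
    norm_num
  rw [h3, div_le_iff₀ (by positivity)] at k2
  exact k2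

lemma even_bound (k : ℕ) (D : ℝ) 
    (h : 4 * (3 * Real.pi) ^ (2 * k) ≤ D * ((((2 * k : ℕ) : ℝ) + 2) * Real.Gamma (((2 * k : ℕ) : ℝ) / 2 + 1)) ^ 2) :
    4 * (3 * 3.1415) ^ (2 * k) ≤ D * ((2 * k + 2) * (k.factorial : ℝ)) ^ 2 := by
  have h1 : (((2 * k : ℕ) : ℝ) / 2 + 1) = (k : ℝ) + 1 := by push_cast; ring
  rw [h1, Real.Gamma_nat_eq_factorial] at h
  push_cast at h
  refine le_trans ?_ h
  have := Real.pi_gt_d4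
  gcongr

lemma odd_bound (k : ℕ) (D : ℝ) 
    (h : 4 * (3 * Real.pi) ^ (2 * k + 1) ≤
      D * ((((2 * k + 1 : ℕ) : ℝ) + 2) * Real.Gamma (((2 * k + 1 : ℕ) : ℝ) / 2 + 1)) ^ 2) :
    4 * 3 * (3 * 3.1415) ^ (2 * k) * 4 ^ (k + 1) ≤
      D * ((2 * k + 3) * ((2 * k + 1).doubleFactorial : ℝ)) ^ 2 := by
  have h1 : (((2 * k + 1 : ℕ) : ℝ) / 2 + 1) = (k : ℝ) + 1 + 1 / 2 := by push_cast; ring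
  rw [h1, Real.Gamma_nat_add_one_add_half] at h
  push_cast at h
  have hpi := Real.pi_pos
  have h2 : (((2 * k + 1 : ℝ) + 2) * (((2 * k + 1).doubleFactorial : ℝ) * √Real.pi / 2 ^ (k + 1))) ^ 2 =
     ((2 * k + 3) * ((2 * k + 1).doubleFactorial : ℝ)) ^ 2 * Real.pi / 4 ^ (k + 1) := by
    have h4 : (4:ℝ) ^ (k + 1) = (2 ^ (k + 1)) ^ 2 := by
      rw [← pow_mul, mul_comm, pow_mul]; norm_num
    rw [h4, mul_pow, div_pow, mul_pow, Real.sq_sqrt hpi.le]; ring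
  rw [h2] at h
  have h3 : 4 * 3 * (3 * Real.pi) ^ (2 * k) * 4 ^ (k + 1) ≤
      D * ((2 * k + 3) * ((2 * k + 1).doubleFactorial : ℝ)) ^ 2 := by
    have h5 : Real.pi * (4 * 3 * (3 * Real.pi) ^ (2 * k) * 4 ^ (k + 1)) ≤
      Real.pi * (D * ((2 * k + 3) * ((2 * k + 1).doubleFactorial : ℝ)) ^ 2) := by
      have h6 := mul_le_mul_of_nonneg_right h (by positivity : (0:ℝ) ≤ 4 ^ (k + 1))
      have h7 : (D * (((2 * k + 3) * ((2 * k + 1).doubleFactorial : ℝ)) ^ 2 * Real.pi / 4 ^ (k + 1)))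
        * 4 ^ (k + 1) = Real.pi * (D * ((2 * k + 3) * ((2 * k + 1).doubleFactorial : ℝ)) ^ 2) := by
        field_simp
      rw [h7] at h6
      refine le_trans (le_of_eq ?_) h6
      ring
    exact le_of_mul_le_mul_left h5 hpi
  refine le_trans ?_ h3
  have := Real.pi_gt_d4
  gcongr

/-- Lower bounds for the determinant of a rank `r` lattice of minimum at least `6`. -/
def detLB : ℕ → ℕ := fun r => [0, 6, 22, 75, 218, 548, 1215, 2408, 4317, 7070, 10653, 14864, 19310, 23471, 26800, 28854, 29388, 28397, 26102, 22878, 19161, 15365].getD r 0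

lemma lower_bound (r D : ℕ) (h1 : 1 ≤ r) (h2 : r ≤ 21)
    (h : 4 * (3 * Real.pi) ^ r ≤ (D : ℝ) * ((r + 2) * Real.Gamma (r / 2 + 1)) ^ 2) :
    detLB r ≤ D := by
  rcases Nat.even_or_odd' r with ⟨k, rfl | rfl⟩
  · have hk := even_bound k D h
    have k1 : 1 ≤ k := by omega
    have k2 : k ≤ 10 := by omega
    clear h h1 h2
    by_contra hc
    have hc' : (D : ℝ) + 1 ≤ ((detLB (2 * k) : ℕ) : ℝ) := by exact_mod_cast not_le.mp hc
    clear hc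
    generalize (D : ℝ) = x at *
    interval_cases k <;> norm_num [Nat.factorial, detLB] at hk hc' <;> linarith
  · have hk := odd_bound k D h
    have k2 : k ≤ 10 := by omega
    clear h h1 h2
    by_contra hc
    have hc' : (D : ℝ) + 1 ≤ ((detLB (2 * k + 1) : ℕ) : ℝ) := by exact_mod_cast not_le.mp hc
    clear hc
    generalize (D : ℝ) = x at *
    interval_cases k <;> norm_num [Nat.doubleFactorial, detLB] at hk hc' <;> linarith

lemma four_pow_le (p : ℕ) (hp : 5 ≤ p) : p ^ 4 ≤ 5 ^ (p - 1) := by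
  obtain ⟨k, rfl⟩ := Nat.exists_eq_add_of_le hp
  induction k with
  | zero => norm_num
  | succ n ih =>
    have ih' := ih (by omega)
    have e : 5 + (n + 1) - 1 = (5 + n - 1) + 1 := by omega
    rw [e, pow_succ]
    have : (5 + (n + 1)) ^ 4 ≤ (5 + n) ^ 4 * 5 := by
      have h1 : 5 * (5 + (n + 1)) ≤ 6 * (5 + n) := by omega
      have h2 := Nat.pow_le_pow_left h1 4
      rw [mul_pow, mul_pow] at h2
      norm_num at h2
      have : 0 ≤ (5 + n) ^ 4 := Nat.zero_le _
      omega
    exact this.trans (Nat.mul_le_mul_right 5 ih')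

lemma numeric (p r D d : ℕ) (hp : p.Prime) (h1 : 1 ≤ r) (h2 : r ≤ 21)
    (h : 4 * (3 * Real.pi) ^ r ≤ (D : ℝ) * ((r + 2) * Real.Gamma (r / 2 + 1)) ^ 2)
    (hD1 : D ∣ 3 * d) (hd : d ^ (p - 1) ∣ p ^ r) (hD2 : D ∣ 3 * p ^ (24 - r))
    (hne : ¬ (p = 2 ∧ r = 1)) : False := by
  have hlb := lower_bound r D h1 h2 h
  clear h
  have hp0 : 0 < p := hp.pos
  have hdle : d ^ (p - 1) ≤ p ^ r := Nat.le_of_dvd (by positivity) hd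
  have hd0 : 0 < d := by
    rcases Nat.eq_zero_or_pos d with rfl | h
    · rw [zero_pow (by have := hp.two_le; omega)] at hd
      have := Nat.eq_zero_of_zero_dvd hd
      have : 0 < p ^ r := by positivity
      omega
    · exact h
  have hD1' : D ≤ 3 * d := Nat.le_of_dvd (by positivity) hD1
  have hD2' : D ≤ 3 * p ^ (24 - r) := Nat.le_of_dvd (by positivity) hD2
  clear hD1 hD2 hd
  have h3 : detLB r ≤ 3 * d := hlb.trans hD1'
  have h4 : detLB r ≤ 3 * p ^ (24 - r) := hlb.trans hD2'
  have hp2 := hp.two_le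
  by_cases hp5 : 5 ≤ p
  · have h5 : d ^ 4 ≤ 5 ^ r := by
      have h6 : (d ^ 4) ^ (p - 1) ≤ (5 ^ r) ^ (p - 1) := by
        calc (d ^ 4) ^ (p - 1) = (d ^ (p - 1)) ^ 4 := by rw [← pow_mul, ← pow_mul, mul_comm]
          _ ≤ (p ^ r) ^ 4 := Nat.pow_le_pow_left hdle 4
          _ = (p ^ 4) ^ r := by rw [← pow_mul, ← pow_mul, mul_comm]
          _ ≤ (5 ^ (p - 1)) ^ r := Nat.pow_le_pow_left (four_pow_le p hp5) r
          _ = (5 ^ r) ^ (p - 1) := by rw [← pow_mul, ← pow_mul, mul_comm]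
      exact (Nat.pow_le_pow_iff_left (by omega)).mp h6
    have h7 : detLB r ^ 4 ≤ 81 * 5 ^ r := by
      calc detLB r ^ 4 ≤ (3 * d) ^ 4 := Nat.pow_le_pow_left h3 4
        _ = 81 * d ^ 4 := by ring
        _ ≤ _ := Nat.mul_le_mul_left _ h5
    clear hdle h3 h4 hlb hD1' hD2' hne
    interval_cases r <;> norm_num [detLB] at h7
  · have : p = 2 ∨ p = 3 := by
      interval_cases p
      · left; rfl
      · right; rfl
      · exact absurd hp (by norm_num)
    rcases this with rfl | rfl
    · simp only [Nat.reduceSub, pow_one] at hdle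
      have h8 : detLB r ≤ 3 * 2 ^ r := h3.trans (Nat.mul_le_mul_left _ hdle)
      clear hdle h3 hlb hD1' hD2'
      interval_cases r <;> first
        | exact absurd h8 (by decide)
        | exact absurd h4 (by decide)
        | exact hne ⟨rfl, rfl⟩
    · have h8 : detLB r ^ 2 ≤ 9 * 3 ^ r := by
        calc detLB r ^ 2 ≤ (3 * d) ^ 2 := Nat.pow_le_pow_left h3 2
          _ = 9 * d ^ 2 := by ring
          _ ≤ _ := Nat.mul_le_mul_left _ hdle
      clear hdle h3 hlb hD1' hD2' hne
      interval_cases r <;> first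
        | exact absurd h8 (by decide)
        | exact absurd h4 (by decide)
/-- almost inverse of the Gram matrix -/
def WW : Matrix (Fin 24) (Fin 24) ℤ :=
  !![0, 1, 0, 0, 0, 0, 0, 0, 0, 0, 0, 0, 0, 0, 0, 0, 0, 0, 0, 0, 0, 0, 0, 0;
    1, 0, 0, 0, 0, 0, 0, 0, 0, 0, 0, 0, 0, 0, 0, 0, 0, 0, 0, 0, 0, 0, 0, 0;
    0, 0, 0, 1, 0, 0, 0, 0, 0, 0, 0, 0, 0, 0, 0, 0, 0, 0, 0, 0, 0, 0, 0, 0;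
    0, 0, 1, 0, 0, 0, 0, 0, 0, 0, 0, 0, 0, 0, 0, 0, 0, 0, 0, 0, 0, 0, 0, 0;
    0, 0, 0, 0, 0, 1, 0, 0, 0, 0, 0, 0, 0, 0, 0, 0, 0, 0, 0, 0, 0, 0, 0, 0;
    0, 0, 0, 0, 1, 0, 0, 0, 0, 0, 0, 0, 0, 0, 0, 0, 0, 0, 0, 0, 0, 0, 0, 0;
    0, 0, 0, 0, 0, 0, -4, -5, -7, -10, -8, -6, -4, -2, 0, 0, 0, 0, 0, 0, 0, 0, 0, 0;
    0, 0, 0, 0, 0, 0, -5, -8, -10, -15, -12, -9, -6, -3, 0, 0, 0, 0, 0, 0, 0, 0, 0, 0;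
    0, 0, 0, 0, 0, 0, -7, -10, -14, -20, -16, -12, -8, -4, 0, 0, 0, 0, 0, 0, 0, 0, 0, 0;
    0, 0, 0, 0, 0, 0, -10, -15, -20, -30, -24, -18, -12, -6, 0, 0, 0, 0, 0, 0, 0, 0, 0, 0;
    0, 0, 0, 0, 0, 0, -8, -12, -16, -24, -20, -15, -10, -5, 0, 0, 0, 0, 0, 0, 0, 0, 0, 0;
    0, 0, 0, 0, 0, 0, -6, -9, -12, -18, -15, -12, -8, -4, 0, 0, 0, 0, 0, 0, 0, 0, 0, 0;
    0, 0, 0, 0, 0, 0, -4, -6, -8, -12, -10, -8, -6, -3, 0, 0, 0, 0, 0, 0, 0, 0, 0, 0;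
    0, 0, 0, 0, 0, 0, -2, -3, -4, -6, -5, -4, -3, -2, 0, 0, 0, 0, 0, 0, 0, 0, 0, 0;
    0, 0, 0, 0, 0, 0, 0, 0, 0, 0, 0, 0, 0, 0, -4, -5, -7, -10, -8, -6, -4, -2, 0, 0;
    0, 0, 0, 0, 0, 0, 0, 0, 0, 0, 0, 0, 0, 0, -5, -8, -10, -15, -12, -9, -6, -3, 0, 0;
    0, 0, 0, 0, 0, 0, 0, 0, 0, 0, 0, 0, 0, 0, -7, -10, -14, -20, -16, -12, -8, -4, 0, 0;
    0, 0, 0, 0, 0, 0, 0, 0, 0, 0, 0, 0, 0, 0, -10, -15, -20, -30, -24, -18, -12, -6, 0, 0;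
    0, 0, 0, 0, 0, 0, 0, 0, 0, 0, 0, 0, 0, 0, -8, -12, -16, -24, -20, -15, -10, -5, 0, 0;
    0, 0, 0, 0, 0, 0, 0, 0, 0, 0, 0, 0, 0, 0, -6, -9, -12, -18, -15, -12, -8, -4, 0, 0;
    0, 0, 0, 0, 0, 0, 0, 0, 0, 0, 0, 0, 0, 0, -4, -6, -8, -12, -10, -8, -6, -3, 0, 0;
    0, 0, 0, 0, 0, 0, 0, 0, 0, 0, 0, 0, 0, 0, -2, -3, -4, -6, -5, -4, -3, -2, 0, 0;
    0, 0, 0, 0, 0, 0, 0, 0, 0, 0, 0, 0, 0, 0, 0, 0, 0, 0, 0, 0, 0, 0, 0, -1;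
    0, 0, 0, 0, 0, 0, 0, 0, 0, 0, 0, 0, 0, 0, 0, 0, 0, 0, 0, 0, 0, 0, 0, -1]

lemma LGram_symm : LGramᵀ = LGram := by decide +kernel

/-- upper half of the Gram matrix -/
def PP : Matrix (Fin 24) (Fin 24) ℤ :=
  fun i j => if i < j then LGram i j else if i = j then LGram i j / 2 else 0

lemma LGram_half : LGram = PP + PPᵀ := by decide +kernel

lemma Bf_symm (v w : Fin 24 → ℤ) : Bf v w = Bf w v := by
  unfold Bf
  rw [dotProduct_mulVec, dotProduct_comm, ← mulVec_transpose, LGram_symm]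

lemma Bf_even (v : Fin 24 → ℤ) : ∃ k, Bf v v = 2 * k := by
  refine ⟨v ⬝ᵥ (PP *ᵥ v), ?_⟩
  unfold Bf
  rw [LGram_half, add_mulVec, dotProduct_add, two_mul]
  congr 1
  rw [mulVec_transpose, dotProduct_comm, ← dotProduct_mulVec]

/-- the bilinear form, bundled -/
noncomputable def BB : (Fin 24 → ℤ) →ₗ[ℤ] (Fin 24 → ℤ) →ₗ[ℤ] ℤ := Matrix.toLinearMap₂' ℤ LGram

lemma Bf_eq (v w : Fin 24 → ℤ) : Bf v w = BB v w := by
  unfold Bf BB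
  rw [Matrix.toLinearMap₂'_apply']

/-- the correction vector -/
def E22 : Fin 24 → ℤ := fun i => if i = 22 then 1 else 0
/-- three times the dual of the correction vector -/
def F22 : Fin 24 → ℤ := fun i => if i = 22 then -2 else if i = 23 then -1 else 0

/-- the discriminant projection -/
def XX : Matrix (Fin 24) (Fin 24) ℤ :=
  fun i j => if i = 22 then (if j = 22 then 1 else if j = 23 then -1 else 0) else 0

lemma LGram_WW : LGram * WW + XX = 1 := by decide +kernel

lemma LGram_F22 : LGram *ᵥ F22 = (3 : ℤ) • E22 := by decide +kernel

lemma XX_mulVec (u : Fin 24 → ℤ) : XX *ᵥ u = (u 22 - u 23) • E22 := by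
  ext i
  by_cases hi : i = 22
  · subst hi
    simp [XX, E22, mulVec, dotProduct, Fin.sum_univ_succ]
    ring
  · simp [XX, E22, mulVec, dotProduct, hi]

lemma LGram_WW_apply (u : Fin 24 → ℤ) : LGram *ᵥ (WW *ᵥ u) + (u 22 - u 23) • E22 = u := by
  have := congrArg (fun M => M *ᵥ u) LGram_WW
  simpa [add_mulVec, XX_mulVec] using this

lemma three_mem (u : Fin 24 → ℤ) : ∃ w, LGram *ᵥ w = (3 : ℤ) • u := by
  refine ⟨(3 : ℤ) • (WW *ᵥ u) + (u 22 - u 23) • F22, ?_⟩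
  conv_rhs => rw [← LGram_WW_apply u]
  rw [mulVec_add, mulVec_smul, mulVec_smul, LGram_F22, smul_add, smul_comm (3 : ℤ)]

lemma index_range_LGram : (LinearMap.range (Matrix.mulVecLin LGram)).toAddSubgroup.index ∣ 3 := by
  let χ : (Fin 24 → ℤ) →+ ZMod 3 :=
    { toFun := fun u => ((u 22 - u 23 : ℤ) : ZMod 3)
      map_zero' := by simp
      map_add' := by intro a b; simp only [Pi.add_apply]; push_cast; ring }
  have h1 : χ.ker ≤ (LinearMap.range (Matrix.mulVecLin LGram)).toAddSubgroup := by
    intro u hu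
    have hu' : ((u 22 - u 23 : ℤ) : ZMod 3) = 0 := hu
    rw [ZMod.intCast_zmod_eq_zero_iff_dvd] at hu'
    obtain ⟨t, ht⟩ := hu'
    refine ⟨WW *ᵥ u + t • F22, ?_⟩
    conv_rhs => rw [← LGram_WW_apply u]
    rw [Matrix.mulVecLin_apply, mulVec_add, mulVec_smul, LGram_F22, ht, smul_smul, mul_comm]
    rfl
  refine (AddSubgroup.index_dvd_of_le h1).trans ?_
  rw [AddSubgroup.index_ker]
  have := AddSubgroup.card_addSubgroup_dvd_card χ.range
  simpa using this

/-- a positive definite rank three piece -/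
def TT : Matrix (Fin 24) (Fin 3) ℤ :=
  fun i j => if i.val = 2 * j.val ∨ i.val = 2 * j.val + 1 then 1 else 0

lemma TT_gram : TTᵀ * LGram * TT = 2 • (1 : Matrix (Fin 3) (Fin 3) ℤ) := by decide +kernel

lemma Bf_TT (t : Fin 3 → ℤ) : Bf (TT *ᵥ t) (TT *ᵥ t) = 2 * (t ⬝ᵥ t) := by
  unfold Bf
  have h : t ⬝ᵥ ((TTᵀ * LGram * TT) *ᵥ t) = 2 * (t ⬝ᵥ t) := by
    rw [TT_gram, smul_mulVec, one_mulVec, dotProduct_smul]; simp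
  rw [← h, ← mulVec_mulVec, ← mulVec_mulVec, mulVec_transpose, dotProduct_comm t,
    ← dotProduct_mulVec, dotProduct_comm, dotProduct_mulVec, ← mulVec_transpose]

open Polynomial in
lemma poly_lemma (p : ℕ) (hp : p.Prime) :
    ∃ u w : ℤ[X], (p : ℤ[X]) = (1 - X) ^ (p - 1) * u + (∑ i ∈ Finset.range p, X ^ i) * w := by
  obtain ⟨n, rfl⟩ : ∃ n, p = n + 1 := ⟨p - 1, by have := hp.pos; omega⟩
  set μ : ℂ := Complex.exp (2 * Real.pi * Complex.I / ((n + 1 : ℕ) : ℂ)) with hμ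
  have hprim : IsPrimitiveRoot μ (n + 1) := Complex.isPrimitiveRoot_exp (n + 1) (by omega)
  have hprod := hprim.prod_one_sub_pow_eq_order
  let u : ℤ[X] := ∏ k ∈ Finset.range n, ∑ i ∈ Finset.range (k + 1), X ^ i
  have hu : (1 - X : ℤ[X]) ^ n * u = ∏ k ∈ Finset.range n, (1 - X ^ (k + 1)) := by
    have : (1 - X : ℤ[X]) ^ n = ∏ k ∈ Finset.range n, (1 - X : ℤ[X]) := by simp
    rw [this, ← Finset.prod_mul_distrib]
    refine Finset.prod_congr rfl fun k _ => ?_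
    rw [mul_neg_geom_sum]
  have hroot : aeval μ (((n + 1 : ℕ) : ℤ[X]) - (1 - X) ^ n * u) = 0 := by
    rw [hu]
    simp only [map_sub, map_prod, map_pow, map_one, aeval_X, map_natCast]
    rw [hprod]; push_cast; ring
  have hdvd := minpoly.isIntegrallyClosed_dvd (hprim.isIntegral (by omega)) hroot
  rw [← cyclotomic_eq_minpoly hprim (by omega)] at hdvd
  have : Fact (n + 1).Prime := ⟨hp⟩
  rw [cyclotomic_prime] at hdvd
  obtain ⟨w, hw⟩ := hdvd
  refine ⟨u, w, ?_⟩
  rw [← hw]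
  simp

/-- determinant divisibility for an endomorphism killed by the norm polynomial -/
lemma det_pow_dvd {M : Type*} [AddCommGroup M] [Module.Free ℤ M] [Module.Finite ℤ M]
    (p : ℕ) (hp : p.Prime) (f : M →ₗ[ℤ] M) (hf : ∑ i ∈ Finset.range p, f ^ i = 0) :
    (LinearMap.det (1 - f)) ^ (p - 1) ∣ (p : ℤ) ^ Module.finrank ℤ M := by
  obtain ⟨u, w, h⟩ := poly_lemma p hp
  have h' := congrArg (Polynomial.aeval f) h
  simp only [map_add, map_mul, map_pow, map_sub, map_one, Polynomial.aeval_X, map_natCast,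
    map_sum, hf, zero_mul, add_zero] at h'
  have h2 := congrArg LinearMap.det h'
  rw [map_mul, map_pow] at h2
  have h3 : ((p : ℕ) : M →ₗ[ℤ] M) = (p : ℤ) • (1 : M →ₗ[ℤ] M) := by
    ext x; simp [Module.End.natCast_apply]
  rw [h3, LinearMap.det_smul, map_one, mul_one] at h2
  exact ⟨_, h2⟩

/-- index of the range of an endomorphism -/
lemma index_range_det {M : Type*} [AddCommGroup M] [Module.Free ℤ M] [Module.Finite ℤ M]
    (f : M →ₗ[ℤ] M) (hf : LinearMap.det f ≠ 0) :
    (LinearMap.range f).toAddSubgroup.index = (LinearMap.det f).natAbs := by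
  have hinj : Function.Injective f := by
    rw [← LinearMap.ker_eq_bot]
    by_contra h
    exact hf (LinearMap.det_eq_zero_iff_ker_ne_bot.mpr h)
  have := Submodule.natAbs_det_equiv (LinearMap.range f) (LinearEquiv.ofInjective f hinj)
  rw [show (LinearMap.range f).subtype ∘ₗ (AddMonoidHom.toIntLinearMap
    ((LinearEquiv.ofInjective f hinj : M ≃ₗ[ℤ] _) : M →+ LinearMap.range f)) = f from by ext; rfl] at this
  rw [this]
  rfl

/-- index of a subgroup -/
noncomputable def idx {M : Type*} [AddCommGroup M] (S : Submodule ℤ M) : ℕ := S.toAddSubgroup.index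

section idx
variable {M N : Type*} [AddCommGroup M] [AddCommGroup N]

lemma idx_dvd_of_le {S T : Submodule ℤ M} (h : S ≤ T) : idx T ∣ idx S :=
  AddSubgroup.index_dvd_of_le (H := S.toAddSubgroup) (K := T.toAddSubgroup) h

lemma idx_map (f : M →ₗ[ℤ] N) (S : Submodule ℤ M) :
    idx (S.map f) = idx (S ⊔ LinearMap.ker f) * idx (LinearMap.range f) := by
  have := AddSubgroup.index_map S.toAddSubgroup f.toAddMonoidHom
  have h1 : S.toAddSubgroup.map f.toAddMonoidHom = (S.map f).toAddSubgroup := rfl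
  have h2 : f.toAddMonoidHom.range = (LinearMap.range f).toAddSubgroup := by
    ext x; rfl
  have h3 : S.toAddSubgroup ⊔ f.toAddMonoidHom.ker = (S ⊔ LinearMap.ker f).toAddSubgroup := by
    ext x
    simp only [AddSubgroup.mem_sup, Submodule.mem_toAddSubgroup, Submodule.mem_sup]
    rfl
  rw [h1, h2, h3] at this
  exact this

lemma idx_top : idx (⊤ : Submodule ℤ M) = 1 := by
  unfold idx
  exact AddSubgroup.index_top

lemma idx_map_surj (f : M →ₗ[ℤ] N) (hf : Function.Surjective f) (S : Submodule ℤ M) :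
    idx (S.map f) = idx (S ⊔ LinearMap.ker f) := by
  rw [idx_map, LinearMap.range_eq_top.mpr hf, idx_top, mul_one]

lemma idx_map_inj (f : M →ₗ[ℤ] N) (hf : Function.Injective f) (S : Submodule ℤ M) :
    idx (S.map f) = idx S * idx (LinearMap.range f) := by
  rw [idx_map, LinearMap.ker_eq_bot.mpr hf, sup_bot_eq]

end idx

lemma inj_of_det {M : Type*} [AddCommGroup M] [Module.Free ℤ M] [Module.Finite ℤ M]
    (f : M →ₗ[ℤ] M) (hf : LinearMap.det f ≠ 0) : Function.Injective f := by
  rw [← LinearMap.ker_eq_bot]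
  by_contra h
  exact hf (LinearMap.det_eq_zero_iff_ker_ne_bot.mpr h)

section lat

variable {r : ℕ} (S : Submodule ℤ (Fin 24 → ℤ)) (b : Module.Basis (Fin r) ℤ S)

/-- pairing with the basis, coordinates -/
noncomputable def rho : (Fin 24 → ℤ) →ₗ[ℤ] (Fin r → ℤ) where
  toFun u i := (b i : Fin 24 → ℤ) ⬝ᵥ u
  map_add' x y := by ext i; simp [dotProduct_add]
  map_smul' c x := by ext i; exact dotProduct_smul c _ x

/-- pairing with the basis -/
noncomputable def phi : (Fin 24 → ℤ) →ₗ[ℤ] (Fin r → ℤ) := (rho S b) ∘ₗ (Matrix.mulVecLin LGram)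

lemma phi_apply (v : Fin 24 → ℤ) (i : Fin r) : phi S b v i = Bf (b i) v := rfl

lemma quot_free (hsat : ∀ (k : ℤ) v, k ≠ 0 → k • v ∈ S → v ∈ S) :
    Module.Free ℤ ((Fin 24 → ℤ) ⧸ S) := by
  have : Module.IsTorsionFree ℤ ((Fin 24 → ℤ) ⧸ S) := by
    rw [Module.isTorsionFree_iff_smul_eq_zero]
    intro k x hx
    obtain ⟨v, rfl⟩ := S.mkQ_surjective x
    rw [← map_smul, Submodule.mkQ_apply, Submodule.Quotient.mk_eq_zero] at hx
    rw [Submodule.mkQ_apply, Submodule.Quotient.mk_eq_zero]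
    by_cases hk : k = 0
    · exact Or.inl hk
    · exact Or.inr (hsat k v hk hx)
  exact Module.free_of_finite_type_torsion_free'

lemma rho_surj (hsat : ∀ (k : ℤ) v, k ≠ 0 → k • v ∈ S → v ∈ S) :
    Function.Surjective (rho S b) := by
  have := quot_free S hsat
  obtain ⟨s, hs⟩ := Module.projective_lifting_property S.mkQ LinearMap.id S.mkQ_surjective
  -- retraction
  have hret : ∀ v : Fin 24 → ℤ, v - s (S.mkQ v) ∈ S := by
    intro v
    rw [← Submodule.Quotient.mk_eq_zero, ← Submodule.mkQ_apply, map_sub]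
    have := LinearMap.congr_fun hs (S.mkQ v)
    simp only [LinearMap.comp_apply, LinearMap.id_apply] at this
    rw [this, sub_self]
  let π : (Fin 24 → ℤ) →ₗ[ℤ] S := LinearMap.codRestrict S (LinearMap.id - s ∘ₗ S.mkQ) hret
  have hπ : ∀ x : S, π x = x := by
    intro x
    apply Subtype.ext
    have : S.mkQ (x : Fin 24 → ℤ) = 0 := by
      rw [Submodule.mkQ_apply, Submodule.Quotient.mk_eq_zero]; exact x.2
    show (x : Fin 24 → ℤ) - s (S.mkQ x) = x
    rw [this, map_zero, sub_zero]
  intro y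
  let F : (Fin 24 → ℤ) →ₗ[ℤ] ℤ := (b.constr ℤ y) ∘ₗ π
  refine ⟨fun k => F (Pi.single k 1), ?_⟩
  ext i
  have h1 : F (b i) = y i := by
    show b.constr ℤ y (π (b i)) = y i
    rw [hπ, Module.Basis.constr_basis]
  rw [← h1]
  conv_rhs => rw [pi_eq_sum_univ' (b i : Fin 24 → ℤ)]
  rw [map_sum]
  show ∑ k : Fin 24, (b i : Fin 24 → ℤ) k * F (Pi.single k 1) = _
  refine Finset.sum_congr rfl fun k _ => ?_
  rw [map_smul, smul_eq_mul]

lemma idx_phi (hsat : ∀ (k : ℤ) v, k ≠ 0 → k • v ∈ S → v ∈ S) :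
    idx (LinearMap.range (phi S b)) ∣ 3 := by
  unfold phi
  rw [LinearMap.range_comp, idx_map_surj _ (rho_surj S b hsat)]
  exact (idx_dvd_of_le le_sup_left).trans index_range_LGram

/-- negated Gram matrix -/
noncomputable def GG : Matrix (Fin r) (Fin r) ℤ := fun i j => - Bf (b i) (b j)

lemma GG_form (x : Fin r → ℤ) : x ⬝ᵥ (GG S b *ᵥ x) = - Bf (b.equivFun.symm x : S) (b.equivFun.symm x : S) := by
  rw [Module.Basis.equivFun_symm_apply, Bf_eq]
  simp only [Submodule.coe_sum, Submodule.coe_smul, map_sum, map_smul, LinearMap.sum_apply, LinearMap.smul_apply, dotProduct, mulVec, GG, Bf_eq, Finset.mul_sum, smul_eq_mul]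
  rw [← Finset.sum_neg_distrib, Finset.sum_comm]
  refine Finset.sum_congr rfl fun i _ => ?_
  rw [← Finset.sum_neg_distrib]
  refine Finset.sum_congr rfl fun j _ => ?_
  ring

lemma idx_phi_S (hG : 0 < (GG S b).det) : idx (S.map (phi S b)) = (GG S b).det.natAbs := by
  have h1 : S.map (phi S b) = LinearMap.range (Matrix.toLin' (GG S b)) := by
    have h2 : phi S b ∘ₗ S.subtype ∘ₗ (b.equivFun.symm : (Fin r → ℤ) →ₗ[ℤ] S) = - Matrix.toLin' (GG S b) := by
      apply LinearMap.ext
      intro x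
      ext i
      simp only [LinearMap.comp_apply, phi_apply, LinearEquiv.coe_coe, Submodule.subtype_apply, LinearMap.neg_apply, Pi.neg_apply, Matrix.toLin'_apply, mulVec, dotProduct]
      rw [Module.Basis.equivFun_symm_apply, Bf_eq]
      simp only [Submodule.coe_sum, Submodule.coe_smul, map_sum, map_smul, GG, Bf_eq, smul_eq_mul]
      rw [← Finset.sum_neg_distrib]
      refine Finset.sum_congr rfl fun j _ => ?_
      ring
    rw [← LinearMap.range_neg, ← h2, LinearMap.range_comp, LinearMap.range_comp, LinearEquiv.range, Submodule.map_top, Submodule.range_subtype]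
  rw [h1]
  have := index_range_det (Matrix.toLin' (GG S b)) (by rw [LinearMap.det_toLin']; exact hG.ne')
  rw [LinearMap.det_toLin'] at this
  exact this

end lat

section prime
variable (h : (Fin 24 → ℤ) ≃ₗ[ℤ] (Fin 24 → ℤ))

lemma mem_coinvL {v : Fin 24 → ℤ} : v ∈ coinvL h ↔ ∀ w ∈ invL h, Bf v w = 0 := Iff.rfl
lemma mem_invL {v : Fin 24 → ℤ} : v ∈ invL h ↔ h v = v := Iff.rfl

lemma coinv_sat (k : ℤ) (v : Fin 24 → ℤ) (hk : k ≠ 0) (hv : k • v ∈ coinvL h) : v ∈ coinvL h := by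
  intro w hw
  have := hv w hw
  rw [Bf_eq, map_smul, LinearMap.smul_apply, smul_eq_mul, ← Bf_eq] at this
  exact (mul_eq_zero.mp this).resolve_left hk

lemma invL_pow (i : ℕ) {w : Fin 24 → ℤ} (hw : w ∈ invL h) : (h ^ i) w = w := by
  induction i with
  | zero => rfl
  | succ n ih => rw [pow_succ, LinearEquiv.mul_apply, (mem_invL h).mp hw, ih]

lemma iso_pow (hiso : IsIsometry h) (i : ℕ) : IsIsometry (h ^ i) := by
  induction i with
  | zero => intro v w; rfl
  | succ n ih => intro v w; rw [pow_succ, LinearEquiv.mul_apply, LinearEquiv.mul_apply, ih, hiso]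

lemma sub_pow_mem (hiso : IsIsometry h) (i : ℕ) (v : Fin 24 → ℤ) : v - (h ^ i) v ∈ coinvL h := by
  intro w hw
  rw [Bf_eq, map_sub, LinearMap.sub_apply, ← Bf_eq, ← Bf_eq]
  have := iso_pow h hiso i v w
  rw [invL_pow h i hw] at this
  rw [this, sub_self]

lemma sub_mem_coinv (hiso : IsIsometry h) (v : Fin 24 → ℤ) : v - h v ∈ coinvL h := by
  simpa using sub_pow_mem h hiso 1 v

lemma map_mem_coinv (hiso : IsIsometry h) {v : Fin 24 → ℤ} (hv : v ∈ coinvL h) : h v ∈ coinvL h := by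
  have := (coinvL h).sub_mem hv (sub_mem_coinv h hiso v)
  simpa using this

/-- the norm -/
def NN (p : ℕ) (v : Fin 24 → ℤ) : Fin 24 → ℤ := ∑ i ∈ Finset.range p, (h ^ i) v

lemma NN_inv (p : ℕ) (hp : h ^ p = 1) (v : Fin 24 → ℤ) : NN h p v ∈ invL h := by
  rw [mem_invL]
  unfold NN
  rw [map_sum]
  have h1 := Finset.sum_range_succ' (fun i => (h ^ i) v) p
  have h2 := Finset.sum_range_succ (fun i => (h ^ i) v) p
  rw [h2, hp] at h1
  have h3 : ∀ i, h ((h ^ i) v) = (h ^ (i + 1)) v := by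
    intro i; rw [pow_succ', LinearEquiv.mul_apply]
  simp only [h3]
  simpa using h1.symm

lemma NN_sub (hiso : IsIsometry h) (p : ℕ) (v : Fin 24 → ℤ) :
    (p : ℤ) • v - NN h p v ∈ coinvL h := by
  have : (p : ℤ) • v - NN h p v = ∑ i ∈ Finset.range p, (v - (h ^ i) v) := by
    rw [Finset.sum_sub_distrib]; simp [NN]
  rw [this]
  exact Submodule.sum_mem _ fun i _ => sub_pow_mem h hiso i v

lemma NN_zero (hiso : IsIsometry h) (p : ℕ) (hp : h ^ p = 1)
    (hneg : ∀ v ∈ coinvL h, v ≠ 0 → Bf v v < 0) (v : Fin 24 → ℤ) (hv : v ∈ coinvL h) :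
    NN h p v = 0 := by
  by_contra hne
  have h1 : NN h p v ∈ coinvL h := by
    have := (coinvL h).sub_mem ((coinvL h).smul_mem (p : ℤ) hv) (NN_sub h hiso p v)
    simpa using this
  have := hneg _ h1 hne
  rw [h1 _ (NN_inv h p hp v)] at this
  exact lt_irrefl _ this

lemma negdef_rank_le (S : Submodule ℤ (Fin 24 → ℤ)) (hneg : ∀ v ∈ S, v ≠ 0 → Bf v v < 0) :
    Module.finrank ℤ S ≤ 21 := by
  let F : (S × (Fin 3 → ℤ)) →ₗ[ℤ] (Fin 24 → ℤ) :=
    LinearMap.coprod S.subtype (Matrix.mulVecLin TT)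
  have hF : Function.Injective F := by
    rw [← LinearMap.ker_eq_bot, LinearMap.ker_eq_bot']
    rintro ⟨s, t⟩ hst
    have h0 : (s : Fin 24 → ℤ) + TT *ᵥ t = 0 := hst
    have h1 : (s : Fin 24 → ℤ) = - (TT *ᵥ t) := eq_neg_of_add_eq_zero_left h0
    have h2 : Bf s s = 2 * (t ⬝ᵥ t) := by
      rw [h1, ← Bf_TT, Bf_eq, Bf_eq]; simp
    have h3 : 0 ≤ t ⬝ᵥ t := Finset.sum_nonneg fun i _ => mul_self_nonneg (t i)
    have hs : s = 0 := by
      by_contra hs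
      have := hneg s s.2 (by simpa using hs)
      omega
    subst hs
    have h4 : t ⬝ᵥ t = 0 := by
      have : Bf ((0 : S) : Fin 24 → ℤ) ((0 : S) : Fin 24 → ℤ) = 0 := by simp [Bf]
      omega
    have : t = 0 := dotProduct_self_eq_zero.mp h4
    rw [this]; rfl
  have := LinearMap.finrank_le_finrank_of_injective hF
  rw [Module.finrank_prod] at this
  simp at this
  omega

/-- restriction to the coinvariant lattice -/
def HS (hiso : IsIsometry h) : coinvL h →ₗ[ℤ] coinvL h :=
  (h : (Fin 24 → ℤ) →ₗ[ℤ] (Fin 24 → ℤ)).restrict fun _ hv => map_mem_coinv h hiso hv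

lemma HS_pow (hiso : IsIsometry h) (i : ℕ) (x : coinvL h) : (((HS h hiso) ^ i) x : Fin 24 → ℤ) = (h ^ i) x := by
  induction i generalizing x with
  | zero => rfl
  | succ n ih => rw [pow_succ, pow_succ, Module.End.mul_apply, ih]; rfl

lemma HS_sum (hiso : IsIsometry h) (p : ℕ) (hp : h ^ p = 1)
    (hneg : ∀ v ∈ coinvL h, v ≠ 0 → Bf v v < 0) : ∑ i ∈ Finset.range p, (HS h hiso) ^ i = 0 := by
  apply LinearMap.ext
  intro x
  apply Subtype.ext
  rw [LinearMap.sum_apply, Submodule.coe_sum]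
  simp only [HS_pow]
  exact NN_zero h hiso p hp hneg x x.2

lemma six_le (hneg : ∀ v ∈ coinvL h, v ≠ 0 → Bf v v < 0) (hW : ∀ v ∈ coinvL h, ¬ InW v)
    (v : Fin 24 → ℤ) (hv : v ∈ coinvL h) (h0 : v ≠ 0) : 6 ≤ - Bf v v := by
  obtain ⟨k, hk⟩ := Bf_even v
  have h1 := hneg v hv h0
  have h2 := hW v hv
  unfold InW at h2
  simp only [not_or] at h2
  omega

/-- index bound coming from the determinant of `1 - h` -/
lemma idx_dvd_det (hiso : IsIsometry h) {r : ℕ} (b : Module.Basis (Fin r) ℤ (coinvL h))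
    (hd : LinearMap.det (1 - HS h hiso) ≠ 0) :
    idx ((coinvL h).map (phi (coinvL h) b)) ∣ 3 * (LinearMap.det (1 - HS h hiso)).natAbs := by
  set Q := LinearMap.toMatrix b b (1 - HS h hiso) with hQ
  have hdet : LinearMap.det (Matrix.toLin' Qᵀ) = LinearMap.det (1 - HS h hiso) := by
    rw [LinearMap.det_toLin', Matrix.det_transpose, hQ, LinearMap.det_toMatrix]
  have hle : (LinearMap.range (phi (coinvL h) b)).map (Matrix.toLin' Qᵀ) ≤
      (coinvL h).map (phi (coinvL h) b) := by
    rintro _ ⟨_, ⟨v, rfl⟩, rfl⟩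
    refine ⟨v - h.symm v, ?_, ?_⟩
    · have := (coinvL h).neg_mem (sub_mem_coinv h hiso (h.symm v))
      simpa using this
    · ext i
      rw [phi_apply, Matrix.toLin'_apply]
      have h1 : Bf (b i) (v - h.symm v) = Bf ((1 - HS h hiso) (b i) : coinvL h) v := by
        have h2 : (((1 - HS h hiso) (b i) : coinvL h) : Fin 24 → ℤ) = (b i : Fin 24 → ℤ) - h (b i) := rfl
        rw [h2, Bf_eq, Bf_eq, map_sub, map_sub, LinearMap.sub_apply, ← Bf_eq, ← Bf_eq, ← Bf_eq,
          ← hiso _ (h.symm v), LinearEquiv.apply_symm_apply]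
      rw [h1, ← b.sum_repr ((1 - HS h hiso) (b i)), Bf_eq]
      simp only [Submodule.coe_sum, Submodule.coe_smul, map_sum, map_smul, LinearMap.sum_apply,
        LinearMap.smul_apply, mulVec, dotProduct, smul_eq_mul, phi_apply, ← Bf_eq]
      refine Finset.sum_congr rfl fun j _ => ?_
      rw [Matrix.transpose_apply, hQ, LinearMap.toMatrix_apply]
  refine (idx_dvd_of_le hle).trans ?_
  rw [idx_map_inj _ (inj_of_det _ (by rw [hdet]; exact hd))]
  have h3 : idx (LinearMap.range (Matrix.toLin' Qᵀ)) = (LinearMap.det (1 - HS h hiso)).natAbs := by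
    rw [← hdet]
    exact index_range_det _ (by rw [hdet]; exact hd)
  rw [h3]
  exact mul_dvd_mul_right (idx_phi _ b (coinv_sat h)) _

lemma idx_dvd_pow (hiso : IsIsometry h) (p : ℕ) (hp0 : p ≠ 0) (hp : h ^ p = 1) {r : ℕ}
    (b : Module.Basis (Fin r) ℤ (coinvL h)) :
    idx ((coinvL h).map (phi (coinvL h) b)) ∣ 3 * p ^ (24 - r) := by
  rw [idx_map, mul_comm]
  refine mul_dvd_mul (idx_phi _ b (coinv_sat h)) ?_
  set K := coinvL h ⊔ LinearMap.ker (phi (coinvL h) b) with hK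
  have hfree := quot_free (coinvL h) (coinv_sat h)
  have h1 : idx K = idx (K.map (coinvL h).mkQ) := by
    rw [idx_map_surj _ (coinvL h).mkQ_surjective, Submodule.ker_mkQ, sup_eq_left.mpr le_sup_left]
  rw [h1]
  have hrank : Module.finrank ℤ ((Fin 24 → ℤ) ⧸ coinvL h) = 24 - r := by
    have h2 := Submodule.finrank_quotient_add_finrank (coinvL h)
    rw [Module.finrank_eq_card_basis b] at h2
    simp at h2
    omega
  have hdet : LinearMap.det ((p : ℤ) • (LinearMap.id : ((Fin 24 → ℤ) ⧸ coinvL h) →ₗ[ℤ] _)) = (p : ℤ) ^ (24 - r) := by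
    rw [LinearMap.det_smul, hrank, LinearMap.det_id, mul_one]
  have h3 := index_range_det ((p : ℤ) • (LinearMap.id : ((Fin 24 → ℤ) ⧸ coinvL h) →ₗ[ℤ] _))
    (by rw [hdet]; exact pow_ne_zero _ (by exact_mod_cast hp0))
  rw [hdet, Int.natAbs_pow, Int.natAbs_natCast] at h3
  rw [← h3]
  apply idx_dvd_of_le
  rintro _ ⟨x, rfl⟩
  obtain ⟨v, rfl⟩ := (coinvL h).mkQ_surjective x
  refine ⟨(p : ℤ) • v, ?_, by rw [map_smul]; rfl⟩
  have h4 : (p : ℤ) • v = ((p : ℤ) • v - NN h p v) + NN h p v := by abel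
  rw [h4]
  refine Submodule.add_mem_sup (NN_sub h hiso p v) ?_
  rw [LinearMap.mem_ker]
  ext i
  rw [phi_apply]
  exact (b i).2 _ (NN_inv h p hp v)

end prime

lemma prime_case (h : (Fin 24 → ℤ) ≃ₗ[ℤ] (Fin 24 → ℤ)) (hiso : IsIsometry h) (p : ℕ)
    (hp : p.Prime) (hpow : h ^ p = 1) (hne : h ≠ 1)
    (hneg : ∀ v ∈ coinvL h, v ≠ 0 → Bf v v < 0) (hW : ∀ v ∈ coinvL h, ¬ InW v) : False := by
  obtain ⟨r, hr⟩ : ∃ r, Module.finrank ℤ (coinvL h) = r := ⟨_, rfl⟩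
  let b : Module.Basis (Fin r) ℤ (coinvL h) := Module.finBasisOfFinrankEq ℤ (coinvL h) hr
  have hr1 : 1 ≤ r := by
    by_contra hlt
    obtain rfl : r = 0 := by omega
    apply hne
    ext1 v
    have hm := sub_mem_coinv h hiso v
    have : (⟨v - h v, hm⟩ : coinvL h) = 0 := by
      rw [← b.sum_repr ⟨v - h v, hm⟩]; simp
    have h2 : v - h v = 0 := congrArg Subtype.val this
    exact (sub_eq_zero.mp h2).symm
  have hr2 : r ≤ 21 := hr ▸ negdef_rank_le (coinvL h) hneg
  have hpos : ∀ x : Fin r → ℤ, x ≠ 0 → 6 ≤ x ⬝ᵥ (GG (coinvL h) b *ᵥ x) := by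
    intro x hx
    rw [GG_form]
    apply six_le h hneg hW _ (Subtype.property _)
    intro h0
    apply hx
    have h1 : b.equivFun.symm x = 0 := Subtype.ext h0
    exact (LinearEquiv.map_eq_zero_iff _).mp h1
  have hsym : (GG (coinvL h) b)ᵀ = GG (coinvL h) b := by
    ext i j
    simp only [Matrix.transpose_apply, GG]
    rw [Bf_symm]
  obtain ⟨hdet, hbl⟩ := blich_matrix hr1 (GG (coinvL h) b) hsym hpos
  have hD := idx_phi_S (coinvL h) b hdet
  have hdv := det_pow_dvd p hp (HS h hiso) (HS_sum h hiso p hpow hneg)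
  rw [hr] at hdv
  have hp1 : p - 1 ≠ 0 := by have := hp.two_le; omega
  have hd0 : LinearMap.det (1 - HS h hiso) ≠ 0 := by
    intro h0
    rw [h0, zero_pow hp1, zero_dvd_iff] at hdv
    exact pow_ne_zero r (by exact_mod_cast hp.ne_zero) hdv
  have hD1 := idx_dvd_det h hiso b hd0
  have hD2 := idx_dvd_pow h hiso p hp.ne_zero hpow b
  rw [hD] at hD1 hD2
  have hdv' : (LinearMap.det (1 - HS h hiso)).natAbs ^ (p - 1) ∣ p ^ r := by
    have := Int.natAbs_dvd_natAbs.mpr hdv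
    simpa [Int.natAbs_pow] using this
  have hcast : (((GG (coinvL h) b).det.natAbs : ℕ) : ℝ) = ((GG (coinvL h) b).det : ℝ) := by
    rw [Nat.cast_natAbs, abs_of_pos hdet]
  by_cases hcase : p = 2 ∧ r = 1
  · obtain ⟨hp2, hr1'⟩ := hcase
    subst hp2
    subst hr1'
    have hdetv : (GG (coinvL h) b).det = - Bf (b 0) (b 0) := by
      rw [Matrix.det_fin_one]; rfl
    have hb0 : (b 0 : Fin 24 → ℤ) ≠ 0 := by
      intro h0
      exact b.ne_zero 0 (Subtype.ext h0)
    have h6 := six_le h hneg hW (b 0) (b 0).2 hb0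
    have hle : (GG (coinvL h) b).det.natAbs ≤ 6 := by
      apply Nat.le_of_dvd (by norm_num)
      refine hD1.trans ?_
      have : (LinearMap.det (1 - HS h hiso)).natAbs ∣ 2 := by simpa using hdv'
      exact mul_dvd_mul_left 3 this
    have h66 : Bf (b 0) (b 0) = -6 := by omega
    apply hW (b 0) (b 0).2
    refine Or.inr (Or.inr (Or.inl ⟨h66, ?_, ?_⟩))
    · intro w
      have hm := sub_mem_coinv h hiso w
      have h1 : w - h w = (b.repr ⟨w - h w, hm⟩ 0) • (b 0 : Fin 24 → ℤ) := by
        have := congrArg Subtype.val (b.sum_repr ⟨w - h w, hm⟩)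
        simpa using this.symm
      have h2 : h (b 0 : Fin 24 → ℤ) = - (b 0 : Fin 24 → ℤ) := by
        have := NN_zero h hiso 2 hpow hneg (b 0) (b 0).2
        unfold NN at this
        rw [Finset.sum_range_succ, Finset.sum_range_one] at this
        rw [pow_zero, pow_one] at this
        exact eq_neg_of_add_eq_zero_right this
      have h3 : Bf (b 0) (w - h w) = 2 * Bf (b 0) w := by
        have h4 := hiso (b 0) w
        rw [h2, Bf_eq, map_neg, LinearMap.neg_apply, ← Bf_eq] at h4
        rw [Bf_eq, map_sub, ← Bf_eq, ← Bf_eq]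
        omega
      rw [h1, Bf_eq, map_smul, ← Bf_eq, h66, smul_eq_mul] at h3
      omega
    · intro e he
      obtain ⟨u, hu⟩ := rho_surj (coinvL h) b (coinv_sat h) (fun _ => 1)
      obtain ⟨w, hw⟩ := three_mem u
      have h1 : (b 0 : Fin 24 → ℤ) ⬝ᵥ u = 1 := congrFun hu 0
      have h2 := he w
      unfold Bf at h2
      rw [hw, dotProduct_smul, h1] at h2
      simpa using h2
  · exact numeric p r (GG (coinvL h) b).det.natAbs (LinearMap.det (1 - HS h hiso)).natAbs hp hr1 hr2
      (by rw [hcast]; exact hbl) hD1 hdv' hD2 hcase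

/-- Any isometry of finite order of `𝐋 = 3U ⊕ 2E8 ⊕ A2` whose coinvariant sublattice is
negative definite and contains no element of `𝒲_{OG10}` is the identity. -/
theorem stmt0 (g : (Fin 24 → ℤ) ≃ₗ[ℤ] (Fin 24 → ℤ)) (hiso : IsIsometry g)
    (hfin : IsOfFinOrder g)
    (hneg : ∀ v ∈ coinvL g, v ≠ 0 → Bf v v < 0)
    (hW : ∀ v ∈ coinvL g, ¬ InW v) :
    g = 1 := by
  by_contra hne
  have hn1 : orderOf g ≠ 1 := by rwa [Ne, orderOf_eq_one_iff]
  have hn0 : 0 < orderOf g := hfin.orderOf_pos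
  obtain ⟨p, hp, k, hk⟩ := Nat.exists_prime_and_dvd hn1
  have hsub : ∀ v ∈ coinvL (g ^ k), v ∈ coinvL g := by
    intro v hv w hw
    exact hv w (invL_pow g k hw)
  refine prime_case (g ^ k) (iso_pow g hiso k) p hp ?_ ?_ (fun v hv => hneg v (hsub v hv))
    (fun v hv => hW v (hsub v hv))
  · rw [← pow_mul, mul_comm, ← hk, pow_orderOf_eq_one]
  · intro h1
    have hdvd := orderOf_dvd_of_pow_eq_one h1
    have hkpos : 0 < k := by
      rcases Nat.eq_zero_or_pos k with h0 | h0
      · subst h0; omega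
      · exact h0
    have := Nat.le_of_dvd hkpos hdvd
    have := hp.two_le
    nlinarith
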